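/- arXiv:2502.05582 — 6 statements merged into one kernel-verified Lean document; each statement's English description precedes it below -/
import Mathlib

section
/- Let (p_j)_{j≥1} be a sequence of real numbers. Then sup_{m≥1} ( m · m! · Σ_{j≥1} |p_j|/(m+j)! ) is finite if and only if Σ_{j≥1} |p_j|/(j+1)! < ∞. Moreover, if Σ_{j≥1} |p_j|/(j+1)! < ∞, then for every m ≥ 1 the series Σ_{j≥1} |p_j|/(m+j)! converges and m · m! · Σ_{j≥1} |p_j|/(m+j)! ≤ 2 · Σ_{j≥1} |p_j|/(j+1)!. -/
open Nat in
theorem mul_factorial_mul_factorial_le {m : ℕ} (hm : 1 ≤ m) (i : ℕ) :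
    m * m ! * (i + 2)! ≤ 2 * (m + i + 1)! := by
  induction i with
  | zero =>
    simp only [zero_add, add_zero, Nat.factorial_succ m, Nat.factorial_two]
    nlinarith [Nat.factorial_pos m]
  | succ i ih =>
    calc m * m ! * (i + 1 + 2)! = (i + 3) * (m * m ! * (i + 2)!) := by
          rw [show i + 1 + 2 = (i + 2) + 1 by ring, Nat.factorial_succ]; ring
      _ ≤ (m + i + 2) * (2 * (m + i + 1)!) := Nat.mul_le_mul (by omega) ih
      _ = 2 * (m + (i + 1) + 1)! := by
          rw [show m + (i + 1) + 1 = (m + i + 1) + 1 by ring, Nat.factorial_succ (m + i + 1)]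
          ring

open Nat in
theorem mul_factorial_mul_div_factorial_le {m : ℕ} (hm : 1 ≤ m) (i : ℕ) {a : ℝ} (ha : 0 ≤ a) :
    (m : ℝ) * (m ! : ℝ) * (a / ((m + i + 1)! : ℝ)) ≤ 2 * (a / ((i + 2)! : ℝ)) := by
  have h : (m : ℝ) * (m ! : ℝ) * ((i + 2)! : ℝ) ≤ 2 * ((m + i + 1)! : ℝ) := by
    exact_mod_cast mul_factorial_mul_factorial_le hm i
  have h₁ : (0 : ℝ) < ((m + i + 1)! : ℝ) := by exact_mod_cast Nat.factorial_pos _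
  have h₂ : (0 : ℝ) < ((i + 2)! : ℝ) := by exact_mod_cast Nat.factorial_pos _
  rw [← mul_div_assoc, ← mul_div_assoc, div_le_div_iff₀ h₁ h₂]
  nlinarith [mul_le_mul_of_nonneg_left h ha]

open Nat in
theorem summable_and_mul_tsum_div_factorial_le {a : ℕ → ℝ} (ha : ∀ i, 0 ≤ a i)
    (hs : Summable fun i : ℕ => a i / ((i + 2)! : ℝ)) {m : ℕ} (hm : 1 ≤ m) :
    (Summable fun i : ℕ => a i / ((m + i + 1)! : ℝ)) ∧
      (m : ℝ) * (m ! : ℝ) * ∑' i : ℕ, a i / ((m + i + 1)! : ℝ) ≤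
        2 * ∑' i : ℕ, a i / ((i + 2)! : ℝ) := by
  have hsum : Summable fun i : ℕ => a i / ((m + i + 1)! : ℝ) := by
    refine hs.of_nonneg_of_le (fun i => div_nonneg (ha i) (Nat.cast_nonneg _)) fun i => ?_
    exact div_le_div_of_nonneg_left (ha i) (by exact_mod_cast Nat.factorial_pos _)
      (by exact_mod_cast Nat.factorial_le (by omega))
  refine ⟨hsum, ?_⟩
  rw [← tsum_mul_left, ← tsum_mul_left]
  exact (hsum.mul_left _).tsum_le_tsum
    (fun i => mul_factorial_mul_div_factorial_le hm i (ha i)) (hs.mul_left 2)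


/-- For a real sequence `(p_j)_{j≥1}`, the quantity
`sup_{m≥1} m·m!·Σ_{j≥1}|p_j|/(m+j)!` is finite iff `Σ_{j≥1}|p_j|/(j+1)! < ∞`;
and in that case, for each `m ≥ 1`, `m·m!·Σ_{j≥1}|p_j|/(m+j)! ≤ 2·Σ_{j≥1}|p_j|/(j+1)!`.
(Here `p i.succ` stands for `p_{i+1}`, so the sums run over `j ≥ 1`.) -/
theorem stmt3 (p : ℕ → ℝ) :
    ((∃ C : ℝ, ∀ m : ℕ, 1 ≤ m →
        (Summable fun i : ℕ => |p (i + 1)| / (Nat.factorial (m + i + 1) : ℝ)) ∧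
        (m : ℝ) * (Nat.factorial m : ℝ) *
          ∑' i : ℕ, |p (i + 1)| / (Nat.factorial (m + i + 1) : ℝ) ≤ C)
      ↔ Summable fun i : ℕ => |p (i + 1)| / (Nat.factorial (i + 2) : ℝ)) ∧
    ((Summable fun i : ℕ => |p (i + 1)| / (Nat.factorial (i + 2) : ℝ)) →
      ∀ m : ℕ, 1 ≤ m →
        (Summable fun i : ℕ => |p (i + 1)| / (Nat.factorial (m + i + 1) : ℝ)) ∧
        (m : ℝ) * (Nat.factorial m : ℝ) *
            ∑' i : ℕ, |p (i + 1)| / (Nat.factorial (m + i + 1) : ℝ) ≤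
          2 * ∑' i : ℕ, |p (i + 1)| / (Nat.factorial (i + 2) : ℝ)) := by
  have key := fun (hs : Summable fun i : ℕ => |p (i + 1)| / (Nat.factorial (i + 2) : ℝ))
      (m : ℕ) (hm : 1 ≤ m) =>
    summable_and_mul_tsum_div_factorial_le (fun i => abs_nonneg (p (i + 1))) hs hm
  refine ⟨⟨?_, fun hs => ⟨_, key hs⟩⟩, key⟩
  rintro ⟨C, hC⟩
  refine (hC 1 le_rfl).1.congr fun i => ?_
  rw [show 1 + i + 1 = i + 2 by ring]
end

section
/- There exist real constants L > 0 and M > 0 such that for every finitely supported function k : ℕ → ℕ with k(0) = 0, setting n := Σ_j j·k(j) and P := Σ_j k(j), one has (n+P)! · Π_j ((j+1)!)^{k(j)} ≤ L · M^P · ((n+1)!)². -/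
open Nat in
theorem factorial_add_two_mul_le (a b : ℕ) : (b + 2)! * (a + 2)! ≤ 2 * (a + b + 2)! := by
  induction b with
  | zero => simp [Nat.factorial_two]
  | succ b ih =>
    have h₁ : (b + 1 + 2)! = (b + 3) * (b + 2)! := Nat.factorial_succ (b + 2)
    have h₂ : (a + (b + 1) + 2)! = (a + b + 3) * (a + b + 2)! := Nat.factorial_succ (a + b + 2)
    rw [h₁, h₂]
    calc (b + 3) * (b + 2)! * (a + 2)! = (b + 3) * ((b + 2)! * (a + 2)!) := by ring
      _ ≤ (a + b + 3) * (2 * (a + b + 2)!) := Nat.mul_le_mul (by omega) ih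
      _ = 2 * ((a + b + 3) * (a + b + 2)!) := by ring

open Nat in
theorem factorial_succ_mul_le (a j : ℕ) : (j + 1)! * (a + 2)! ≤ 2 * (a + (j - 1) + 2)! := by
  cases j with
  | zero => simp; omega
  | succ b => exact factorial_add_two_mul_le a b

open Nat in
theorem factorial_succ_pow_mul_le (a j e : ℕ) :
    (j + 1)! ^ e * (a + 2)! ≤ 2 ^ e * (a + (j - 1) * e + 2)! := by
  induction e with
  | zero => simp
  | succ e ih =>
    calc (j + 1)! ^ (e + 1) * (a + 2)! = (j + 1)! * ((j + 1)! ^ e * (a + 2)!) := by ring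
      _ ≤ (j + 1)! * (2 ^ e * (a + (j - 1) * e + 2)!) := Nat.mul_le_mul_left _ ih
      _ = 2 ^ e * ((j + 1)! * (a + (j - 1) * e + 2)!) := by ring
      _ ≤ 2 ^ e * (2 * (a + (j - 1) * e + (j - 1) + 2)!) :=
        Nat.mul_le_mul_left _ (factorial_succ_mul_le _ j)
      _ = 2 ^ (e + 1) * (a + (j - 1) * (e + 1) + 2)! := by
        rw [show a + (j - 1) * (e + 1) + 2 = a + (j - 1) * e + (j - 1) + 2 by ring]
        ring

open Nat in
theorem prod_factorial_succ_pow_le (s : Finset ℕ) (k : ℕ → ℕ) :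
    ∏ j ∈ s, (j + 1)! ^ k j ≤ 2 ^ (∑ j ∈ s, k j) * (∑ j ∈ s, (j - 1) * k j + 2)! := by
  induction s using Finset.induction_on with
  | empty => simp
  | insert j s hj ih =>
    rw [Finset.prod_insert hj, Finset.sum_insert hj, Finset.sum_insert hj]
    calc _ ≤ (j + 1)! ^ k j * (2 ^ (∑ i ∈ s, k i) * (∑ i ∈ s, (i - 1) * k i + 2)!) :=
          Nat.mul_le_mul_left _ ih
      _ = 2 ^ (∑ i ∈ s, k i) * ((j + 1)! ^ k j * (∑ i ∈ s, (i - 1) * k i + 2)!) := by ring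
      _ ≤ 2 ^ (∑ i ∈ s, k i) * (2 ^ k j * (∑ i ∈ s, (i - 1) * k i + (j - 1) * k j + 2)!) :=
        Nat.mul_le_mul_left _ (factorial_succ_pow_mul_le _ j _)
      _ = _ := by rw [pow_add, add_comm ((j - 1) * k j)]; ring

open Nat in
theorem factorial_two_mul_add_mul_factorial_le (p m : ℕ) :
    (2 * p + m)! * m ! ≤ 4 ^ p * (p + m)! ^ 2 := by
  induction m with
  | zero =>
    have h : p.centralBinom * p ! * p ! = (2 * p)! := by
      have := Nat.choose_mul_factorial_mul_factorial (show p ≤ 2 * p by omega)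
      rwa [show 2 * p - p = p by omega] at this
    have hc : p.centralBinom ≤ 4 ^ p := by
      have := Nat.choose_le_two_pow (2 * p) p
      rwa [pow_mul] at this
    simp only [add_zero, Nat.factorial_zero, mul_one]
    rw [← h, mul_assoc, ← sq]
    exact Nat.mul_le_mul_right _ hc
  | succ m ih =>
    rw [← add_assoc, ← add_assoc, Nat.factorial_succ, Nat.factorial_succ, Nat.factorial_succ]
    calc _ = ((2 * p + m + 1) * (m + 1)) * ((2 * p + m)! * m !) := by ring
      _ ≤ (p + m + 1) ^ 2 * (4 ^ p * (p + m)! ^ 2) := Nat.mul_le_mul (by nlinarith) ih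
      _ = _ := by ring

open Nat in
theorem factorial_mul_prod_factorial_succ_pow_le (s : Finset ℕ) (k : ℕ → ℕ) (h0 : 0 ∉ s) :
    (∑ j ∈ s, j * k j + ∑ j ∈ s, k j)! * ∏ j ∈ s, (j + 1)! ^ k j ≤
      8 ^ (∑ j ∈ s, k j) * (∑ j ∈ s, j * k j + 1)! ^ 2 := by
  have hn : ∑ j ∈ s, j * k j = ∑ j ∈ s, (j - 1) * k j + ∑ j ∈ s, k j := by
    rw [← Finset.sum_add_distrib]
    refine Finset.sum_congr rfl fun j hj => ?_
    obtain ⟨i, rfl⟩ := Nat.exists_eq_succ_of_ne_zero (ne_of_mem_of_not_mem hj h0)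
    simp [Nat.succ_mul]
  have hprod := prod_factorial_succ_pow_le s k
  rw [hn]
  rcases Nat.eq_zero_or_pos (∑ j ∈ s, k j) with hP | hP
  · have hk : ∀ j ∈ s, k j = 0 := Finset.sum_eq_zero_iff.mp hP
    rw [hP, Finset.prod_eq_one fun j hj => by rw [hk j hj, pow_zero],
      Finset.sum_eq_zero fun j hj => by rw [hk j hj, mul_zero]]
    simp
  · generalize ∑ j ∈ s, (j - 1) * k j = q at *
    obtain ⟨p, hp⟩ : ∃ p, ∑ j ∈ s, k j = p + 1 := ⟨_, (Nat.sub_add_cancel hP).symm⟩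
    rw [hp] at hprod ⊢
    calc _ ≤ (q + (p + 1) + (p + 1))! * (2 ^ (p + 1) * (q + 2)!) := Nat.mul_le_mul_left _ hprod
      _ = 2 ^ (p + 1) * ((2 * p + (q + 2))! * (q + 2)!) := by
        rw [show q + (p + 1) + (p + 1) = 2 * p + (q + 2) by ring]; ring
      _ ≤ 2 ^ (p + 1) * (4 ^ p * (p + (q + 2))! ^ 2) :=
        Nat.mul_le_mul_left _ (factorial_two_mul_add_mul_factorial_le p (q + 2))
      _ ≤ 2 ^ (p + 1) * (4 ^ (p + 1) * (p + (q + 2))! ^ 2) := by gcongr <;> omega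
      _ = 8 ^ (p + 1) * (q + (p + 1) + 1)! ^ 2 := by
        rw [show q + (p + 1) + 1 = p + (q + 2) by ring, ← mul_assoc, ← mul_pow]; norm_num

/-- There are constants `L, M > 0` such that for every finitely supported
`k : ℕ → ℕ` with `k 0 = 0`, setting `n = Σ_j j·k_j` and `P = Σ_j k_j`,
one has `(n+P)!·Π_j ((j+1)!)^{k_j} ≤ L·M^P·((n+1)!)²`. -/
theorem stmt9 : ∃ L M : ℝ, 0 < L ∧ 0 < M ∧
    ∀ k : ℕ →₀ ℕ, k 0 = 0 →
      (Nat.factorial ((∑ j ∈ k.support, j * k j) + ∑ j ∈ k.support, k j) : ℝ) *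
          ∏ j ∈ k.support, (Nat.factorial (j + 1) : ℝ) ^ k j ≤
        L * M ^ (∑ j ∈ k.support, k j) *
          (Nat.factorial ((∑ j ∈ k.support, j * k j) + 1) : ℝ) ^ 2 := by
  refine ⟨1, 8, one_pos, by norm_num, fun k hk => ?_⟩
  rw [one_mul]
  exact_mod_cast factorial_mul_prod_factorial_succ_pow_le k.support k (by simpa using hk)
end

section
/- Let B be a normed ℝ-algebra (not necessarily commutative) whose norm satisfies ‖x·y‖ ≤ ‖x‖·‖y‖, let t ≥ 0, and let (x_n)_{n≥1} be elements of B such that ‖x₁‖ ≤ t, ‖x₂‖ ≤ t², and for every n ≥ 3 one has (n−2)·x_n = x₁·x_{n−1} − x_{n−1}·x₁ (scalar multiplication by the real number n−2). Then for every n ≥ 2, ‖x_n‖ ≤ 2^{n−2} · t^n / (n−2)!. -/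
/-- In a normed `ℝ`-algebra with submultiplicative norm, if `‖x₁‖ ≤ t`, `‖x₂‖ ≤ t²`
and `(n−2)·xₙ = x₁x_{n−1} − x_{n−1}x₁` for `n ≥ 3`, then
`‖xₙ‖ ≤ 2^{n−2}·tⁿ/(n−2)!` for all `n ≥ 2`. -/
theorem stmt14 {B : Type*} [NormedRing B] [NormedAlgebra ℝ B]
    (hmul : ∀ x y : B, ‖x * y‖ ≤ ‖x‖ * ‖y‖)
    (t : ℝ) (ht : 0 ≤ t) (x : ℕ → B)
    (h1 : ‖x 1‖ ≤ t) (h2 : ‖x 2‖ ≤ t ^ 2)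
    (hrec : ∀ n : ℕ, 3 ≤ n → ((n : ℝ) - 2) • x n = x 1 * x (n - 1) - x (n - 1) * x 1) :
    ∀ n : ℕ, 2 ≤ n → ‖x n‖ ≤ 2 ^ (n - 2) * t ^ n / (Nat.factorial (n - 2) : ℝ) := by
  intro n hn
  obtain ⟨k, rfl⟩ := Nat.exists_eq_add_of_le' hn
  rw [Nat.add_sub_cancel]
  clear hn
  induction k with
  | zero => simpa using h2
  | succ k ih =>
    have hk : (0 : ℝ) < k + 1 := by positivity
    have hx : ((k : ℝ) + 1) • x (k + 1 + 2) = x 1 * x (k + 2) - x (k + 2) * x 1 := by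
      have h := hrec (k + 1 + 2) (by omega)
      rwa [Nat.cast_add, Nat.cast_ofNat, add_sub_cancel_right, Nat.cast_succ,
        show k + 1 + 2 - 1 = k + 2 by omega] at h
    have hnorm : ((k : ℝ) + 1) * ‖x (k + 1 + 2)‖ ≤ 2 * t * ‖x (k + 2)‖ := by
      calc ((k : ℝ) + 1) * ‖x (k + 1 + 2)‖ = ‖x 1 * x (k + 2) - x (k + 2) * x 1‖ := by
            rw [← hx, norm_smul, Real.norm_of_nonneg hk.le]
        _ ≤ ‖x 1 * x (k + 2)‖ + ‖x (k + 2) * x 1‖ := norm_sub_le _ _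
        _ ≤ ‖x 1‖ * ‖x (k + 2)‖ + ‖x (k + 2)‖ * ‖x 1‖ := add_le_add (hmul _ _) (hmul _ _)
        _ = 2 * ‖x 1‖ * ‖x (k + 2)‖ := by ring
        _ ≤ 2 * t * ‖x (k + 2)‖ := by gcongr
    calc ‖x (k + 1 + 2)‖ ≤ 2 * t * ‖x (k + 2)‖ / (k + 1) := by
          rwa [le_div_iff₀' hk]
      _ ≤ 2 * t * (2 ^ k * t ^ (k + 2) / (k.factorial : ℝ)) / (k + 1) := by gcongr
      _ = 2 ^ (k + 1) * t ^ (k + 1 + 2) / ((k + 1).factorial : ℝ) := by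
          rw [Nat.factorial_succ]
          push_cast
          field_simp
          ring
end

section
/- Let B be a normed ℝ-algebra whose norm satisfies ‖x·y‖ ≤ ‖x‖·‖y‖, let t ≥ 0, and let (x_n)_{n≥1} be elements of B with ‖x₁‖ ≤ t, ‖x₂‖ ≤ t², and (n−2)·x_n = x₁·x_{n−1} − x_{n−1}·x₁ for all n ≥ 3. Let (p_n)_{n≥1} be real numbers with Σ_{n≥2} |p_n|·(2t)^n/(n−2)! < ∞. Then the family (p_n·x_n)_{n≥1} is absolutely summable and Σ_{n≥1} ‖p_n·x_n‖ ≤ |p₁|·t + (1/4)·Σ_{n≥2} |p_n|·(2t)^n/(n−2)!. -/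
/-- The commutator with an element of norm at most `t` has norm at most `2 * t`; dividing by `n - 2`
at each step produces the factorial. -/
theorem norm_le_of_smul_eq_commutator {B : Type*} [NormedRing B] [NormedAlgebra ℝ B]
    {t : ℝ} {x : ℕ → B} (h1 : ‖x 1‖ ≤ t) (h2 : ‖x 2‖ ≤ t ^ 2)
    (hrec : ∀ n : ℕ, 3 ≤ n → ((n : ℝ) - 2) • x n = x 1 * x (n - 1) - x (n - 1) * x 1) (i : ℕ) :
    ‖x (i + 2)‖ ≤ (1 / 4) * ((2 * t) ^ (i + 2) / (Nat.factorial i : ℝ)) := by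
  have ht : 0 ≤ t := (norm_nonneg _).trans h1
  induction i with
  | zero =>
    refine h2.trans (le_of_eq ?_)
    simp only [Nat.factorial_zero, Nat.cast_one]
    ring
  | succ k ih =>
    have hk : (0 : ℝ) < k + 1 := by positivity
    have hcomm : ((k : ℝ) + 1) • x (k + 3) = x 1 * x (k + 2) - x (k + 2) * x 1 := by
      have h := hrec (k + 3) (by omega)
      have hc : ((k + 3 : ℕ) : ℝ) - 2 = k + 1 := by
        push_cast
        ring
      rwa [hc] at h
    have hstep : ((k : ℝ) + 1) * ‖x (k + 3)‖ ≤ 2 * t * ‖x (k + 2)‖ :=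
      calc ((k : ℝ) + 1) * ‖x (k + 3)‖ = ‖x 1 * x (k + 2) - x (k + 2) * x 1‖ := by
            rw [← hcomm, norm_smul, Real.norm_of_nonneg hk.le]
        _ ≤ ‖x 1‖ * ‖x (k + 2)‖ + ‖x (k + 2)‖ * ‖x 1‖ :=
            (norm_sub_le _ _).trans (add_le_add (norm_mul_le _ _) (norm_mul_le _ _))
        _ = 2 * ‖x 1‖ * ‖x (k + 2)‖ := by ring
        _ ≤ 2 * t * ‖x (k + 2)‖ := by gcongr
    refine le_of_mul_le_mul_left (hstep.trans ?_) hk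
    calc 2 * t * ‖x (k + 2)‖
        ≤ 2 * t * ((1 / 4) * ((2 * t) ^ (k + 2) / (Nat.factorial k : ℝ))) := by gcongr
      _ = (k + 1) * ((1 / 4) * ((2 * t) ^ (k + 1 + 2) / (Nat.factorial (k + 1) : ℝ))) := by
          have hf : (Nat.factorial k : ℝ) ≠ 0 := by positivity
          rw [Nat.factorial_succ]
          push_cast
          field_simp
          ring

/-- In a normed `ℝ`-algebra with submultiplicative norm, if `‖x₁‖ ≤ t`, `‖x₂‖ ≤ t²`,
`(n−2)·xₙ = x₁x_{n−1} − x_{n−1}x₁` for `n ≥ 3`, and `Σ_{n≥2}|p_n|(2t)ⁿ/(n−2)! < ∞`,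
then `(p_n·x_n)_{n≥1}` is absolutely summable with
`Σ_{n≥1}‖p_n·x_n‖ ≤ |p₁|t + (1/4)·Σ_{n≥2}|p_n|(2t)ⁿ/(n−2)!`.
(Here the index shift `n = i+2` turns `(n−2)!` into `i!`.) -/
theorem stmt15 {B : Type*} [NormedRing B] [NormedAlgebra ℝ B]
    (hmul : ∀ x y : B, ‖x * y‖ ≤ ‖x‖ * ‖y‖)
    (t : ℝ) (ht : 0 ≤ t) (x : ℕ → B)
    (h1 : ‖x 1‖ ≤ t) (h2 : ‖x 2‖ ≤ t ^ 2)
    (hrec : ∀ n : ℕ, 3 ≤ n → ((n : ℝ) - 2) • x n = x 1 * x (n - 1) - x (n - 1) * x 1)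
    (p : ℕ → ℝ)
    (hp : Summable fun i : ℕ => |p (i + 2)| * (2 * t) ^ (i + 2) / (Nat.factorial i : ℝ)) :
    (Summable fun i : ℕ => ‖p (i + 1) • x (i + 1)‖) ∧
      ∑' i : ℕ, ‖p (i + 1) • x (i + 1)‖ ≤
        |p 1| * t + (1 / 4) * ∑' i : ℕ, |p (i + 2)| * (2 * t) ^ (i + 2) / (Nat.factorial i : ℝ) := by
  have hbound (i : ℕ) : ‖p (i + 2) • x (i + 2)‖ ≤
      (1 / 4) * (|p (i + 2)| * (2 * t) ^ (i + 2) / (Nat.factorial i : ℝ)) := by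
    rw [norm_smul, Real.norm_eq_abs]
    calc |p (i + 2)| * ‖x (i + 2)‖
        ≤ |p (i + 2)| * ((1 / 4) * ((2 * t) ^ (i + 2) / (Nat.factorial i : ℝ))) := by
          gcongr
          exact norm_le_of_smul_eq_commutator h1 h2 hrec i
      _ = _ := by ring
  have htail : Summable fun i : ℕ => ‖p (i + 2) • x (i + 2)‖ :=
    .of_nonneg_of_le (fun _ => norm_nonneg _) hbound (hp.mul_left _)
  have hsum : Summable fun i : ℕ => ‖p (i + 1) • x (i + 1)‖ :=
    (summable_nat_add_iff 1).1 htail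
  refine ⟨hsum, ?_⟩
  rw [hsum.tsum_eq_zero_add, ← tsum_mul_left]
  refine add_le_add ?_ (htail.tsum_le_tsum hbound (hp.mul_left _))
  rw [norm_smul, Real.norm_eq_abs]
  exact mul_le_mul_of_nonneg_left h1 (abs_nonneg _)
end

section
/- Let H be a real Banach space and let (ℓ_n)_{n≥1} be bounded linear operators on H satisfying the relations ℓ_n∘ℓ_m − ℓ_m∘ℓ_n = (m−n)·ℓ_{n+m} for all n, m ≥ 1. Let (p_j)_{j≥1} be real numbers such that for every σ > 0 the series Σ_{j≥1} |p_j|·σ^j/(j+1)! converges. Then Σ_{j≥1} ‖p_j·ℓ_j‖ < ∞, i.e. the series Σ_{j≥1} p_j ℓ_j converges absolutely in operator norm. -/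
/-- Factorial decay of a bounded representation of the formal vector fields on the line: since
`[ℓ 1, ℓ n] = (n - 1) • ℓ (n + 1)`, the norms `‖ℓ n‖` are `O(σ ^ n / (n + 1)!)` for some `σ`. -/
theorem norm_mul_factorial_le_of_commutator {H : Type*} [NormedAddCommGroup H] [NormedSpace ℝ H]
    (ℓ : ℕ → H →L[ℝ] H)
    (hrel : ∀ n : ℕ, 1 ≤ n →
      (ℓ 1).comp (ℓ n) - (ℓ n).comp (ℓ 1) = ((n : ℝ) - 1) • ℓ (1 + n)) (k : ℕ) :
    ‖ℓ (k + 2)‖ * (Nat.factorial (k + 3) : ℝ) ≤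
      6 * ‖ℓ 2‖ * (8 * ‖ℓ 1‖ + 1) ^ (k + 2) := by
  have hσ : 1 ≤ 8 * ‖ℓ 1‖ + 1 := by linarith [norm_nonneg (ℓ 1)]
  induction k with
  | zero =>
    have h6 : (Nat.factorial (0 + 3) : ℝ) = 6 := by norm_num [Nat.factorial]
    rw [h6, mul_comm ‖_‖]
    exact le_mul_of_one_le_right (by positivity) (one_le_pow₀ hσ)
  | succ k ih =>
    have hstep : ((k : ℝ) + 1) * ‖ℓ (k + 3)‖ ≤ 2 * ‖ℓ 1‖ * ‖ℓ (k + 2)‖ := by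
      have h := congrArg norm (hrel (k + 2) (by omega))
      have hc : (((k + 2 : ℕ) : ℝ) - 1) = (k : ℝ) + 1 := by push_cast; ring
      rw [hc, norm_smul, Real.norm_of_nonneg (by positivity),
        show 1 + (k + 2) = k + 3 by omega] at h
      rw [← h]
      refine (norm_sub_le _ _).trans ?_
      linarith [(ℓ 1).opNorm_comp_le (ℓ (k + 2)), (ℓ (k + 2)).opNorm_comp_le (ℓ 1)]
    have hstep' : ‖ℓ (k + 3)‖ * ((k : ℝ) + 4) ≤ (8 * ‖ℓ 1‖ + 1) * ‖ℓ (k + 2)‖ := by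
      have : 0 ≤ (k : ℝ) * ‖ℓ (k + 3)‖ := by positivity
      linarith [norm_nonneg (ℓ (k + 2))]
    rw [show k + 1 + 3 = (k + 3) + 1 by omega, Nat.factorial_succ,
      show k + 1 + 2 = k + 3 by omega]
    push_cast
    calc ‖ℓ (k + 3)‖ * (((k : ℝ) + 3 + 1) * (Nat.factorial (k + 3) : ℝ))
        = ‖ℓ (k + 3)‖ * ((k : ℝ) + 4) * (Nat.factorial (k + 3) : ℝ) := by ring
      _ ≤ (8 * ‖ℓ 1‖ + 1) * ‖ℓ (k + 2)‖ * (Nat.factorial (k + 3) : ℝ) := by gcongr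
      _ = (8 * ‖ℓ 1‖ + 1) * (‖ℓ (k + 2)‖ * (Nat.factorial (k + 3) : ℝ)) := by ring
      _ ≤ (8 * ‖ℓ 1‖ + 1) * (6 * ‖ℓ 2‖ * (8 * ‖ℓ 1‖ + 1) ^ (k + 2)) := by gcongr
      _ = 6 * ‖ℓ 2‖ * (8 * ‖ℓ 1‖ + 1) ^ (k + 3) := by ring


/-- If bounded operators `ℓ_n` (`n ≥ 1`) on a real Banach space satisfy
`[ℓ_n, ℓ_m] = (m−n)·ℓ_{n+m}` (a bounded representation of the Lie algebra of formal
vector fields), and `Σ_{j≥1}|p_j|σ^j/(j+1)! < ∞` for every `σ > 0` (i.e. `Σ p_j L_j`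
lies in `vect°`), then `Σ_{j≥1}‖p_j·ℓ_j‖ < ∞`. -/
theorem stmt16 {H : Type*} [NormedAddCommGroup H] [NormedSpace ℝ H] [CompleteSpace H]
    (ℓ : ℕ → H →L[ℝ] H)
    (hrel : ∀ n m : ℕ, 1 ≤ n → 1 ≤ m →
      (ℓ n).comp (ℓ m) - (ℓ m).comp (ℓ n) = ((m : ℝ) - (n : ℝ)) • ℓ (n + m))
    (p : ℕ → ℝ)
    (hp : ∀ σ : ℝ, 0 < σ →
      Summable fun i : ℕ => |p (i + 1)| * σ ^ (i + 1) / (Nat.factorial (i + 2) : ℝ)) :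
    Summable fun i : ℕ => ‖p (i + 1) • ℓ (i + 1)‖ := by
  have hbound := norm_mul_factorial_le_of_commutator ℓ fun n hn => by
    simpa using hrel 1 n le_rfl hn
  rw [← summable_nat_add_iff 1]
  refine Summable.of_nonneg_of_le (fun _ => norm_nonneg _) (fun i => ?_)
    (((summable_nat_add_iff 1).2 (hp (8 * ‖ℓ 1‖ + 1) (by positivity))).mul_left (6 * ‖ℓ 2‖))
  rw [norm_smul, Real.norm_eq_abs, mul_div_assoc, mul_left_comm, ← mul_div_assoc]
  gcongr
  rw [le_div_iff₀ (by positivity)]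
  exact hbound i
end

section
/- Let A be the free associative ℝ-algebra on two generators ω₀, ω₁, with basis of monomials ω^I indexed by words I in the free monoid on two letters; write w = Σ_I c_I(w)·ω^I and let d₀(I), d₁(I) count occurrences of the letters. Let φ : A → End_ℝ(ℝ[x]) be the ℝ-algebra homomorphism into linear endomorphisms of the real polynomial ring determined by φ(ω₀) = L₁ and φ(ω₁) = L₂, where for n ≥ 1, L_n denotes the linear map f ↦ x^{n+1}·f′ (f′ the derivative). Let t > 0, let N ≥ 1, let p₁, …, p_N be real numbers, and suppose w ∈ A satisfies φ(w) = Σ_{j=1}^{N} p_j·L_j as endomorphisms of ℝ[x]. Then Σ_I |c_I(w)| · t^{d₀(I)} · t^{2·d₁(I)} ≥ Σ_{j=1}^{N} |p_j|·t^j/(j+1)!. -/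
open FreeAlgebra

/-- The operator `L_n = x^{n+1} d/dx` on the polynomial ring `ℝ[x]`. -/
noncomputable def Lop (n : ℕ) : Module.End ℝ (Polynomial ℝ) :=
  (LinearMap.mulLeft ℝ (Polynomial.X ^ (n + 1))).comp Polynomial.derivative

/-- The weighted `ℓ¹` norm `Σ |u_m| t^m / m!` of a polynomial `Σ u_m x^m`. -/
noncomputable def expNorm (t : ℝ) (f : Polynomial ℝ) : ℝ :=
  f.sum fun m a => |a| * (t ^ m / (Nat.factorial m : ℝ))

theorem expNorm_eq_sum {t : ℝ} {f : Polynomial ℝ} {s : Finset ℕ} (hs : f.support ⊆ s) :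
    expNorm t f = ∑ m ∈ s, |f.coeff m| * (t ^ m / (Nat.factorial m : ℝ)) :=
  Polynomial.sum_eq_of_subset _ (by simp) hs

@[simp]
theorem expNorm_zero (t : ℝ) : expNorm t 0 = 0 := by simp [expNorm]

@[simp]
theorem expNorm_monomial (t : ℝ) (m : ℕ) (a : ℝ) :
    expNorm t (Polynomial.monomial m a) = |a| * (t ^ m / (Nat.factorial m : ℝ)) :=
  Polynomial.sum_monomial_index a _ (by simp)

theorem expNorm_smul (t a : ℝ) (f : Polynomial ℝ) :
    expNorm t (a • f) = |a| * expNorm t f := by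
  rw [expNorm_eq_sum (Polynomial.support_smul a f), expNorm_eq_sum subset_rfl, Finset.mul_sum]
  simp [abs_mul, mul_assoc]

theorem expNorm_add_le {t : ℝ} (ht : 0 ≤ t) (f g : Polynomial ℝ) :
    expNorm t (f + g) ≤ expNorm t f + expNorm t g := by
  classical
  rw [expNorm_eq_sum (Polynomial.support_add (p := f) (q := g)),
    expNorm_eq_sum (Finset.subset_union_left (s₁ := f.support) (s₂ := g.support)),
    expNorm_eq_sum (Finset.subset_union_right (s₁ := f.support) (s₂ := g.support)),
    ← Finset.sum_add_distrib]
  refine Finset.sum_le_sum fun m _ => ?_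
  rw [← add_mul, Polynomial.coeff_add]
  exact mul_le_mul_of_nonneg_right (abs_add_le _ _) (by positivity)

theorem expNorm_sum_le {ι : Type*} {t : ℝ} (ht : 0 ≤ t) (s : Finset ι)
    (f : ι → Polynomial ℝ) : expNorm t (∑ i ∈ s, f i) ≤ ∑ i ∈ s, expNorm t (f i) :=
  Finset.le_sum_of_subadditive (expNorm t) (expNorm_zero t).le (expNorm_add_le ht) s f

theorem Lop_monomial (n m : ℕ) (a : ℝ) :
    Lop n (Polynomial.monomial m a) = Polynomial.monomial (m + n) (a * m) := by
  rcases m with _ | m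
  · simp [Lop]
  · simp only [Lop, LinearMap.comp_apply, LinearMap.mulLeft_apply, Polynomial.derivative_monomial,
      Polynomial.X_pow_mul_monomial]
    rw [Nat.add_sub_cancel, show m + (n + 1) = m + 1 + n by omega]

theorem Lop_X (n : ℕ) : Lop n Polynomial.X = Polynomial.monomial (n + 1) 1 := by
  simpa [Polynomial.X, add_comm] using Lop_monomial n 1 1

theorem expNorm_Lop_le {t : ℝ} (ht : 0 ≤ t) {n : ℕ} (hn : 1 ≤ n) (f : Polynomial ℝ) :
    expNorm t (Lop n f) ≤ t ^ n * expNorm t f := by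
  conv_lhs => rw [f.as_sum_support, map_sum]
  refine (expNorm_sum_le ht _ _).trans ?_
  rw [expNorm_eq_sum (f := f) subset_rfl, Finset.mul_sum]
  refine Finset.sum_le_sum fun m _ => ?_
  have key : (m : ℝ) / (Nat.factorial (m + n) : ℝ) ≤ 1 / (Nat.factorial m : ℝ) := by
    rw [div_le_div_iff₀ (by positivity) (by positivity), one_mul]
    have h : m * Nat.factorial m ≤ Nat.factorial (m + n) :=
      (Nat.mul_le_mul_right _ m.le_succ).trans
        (Nat.factorial_le (Nat.add_le_add_left hn m))
    exact_mod_cast h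
  rw [Lop_monomial, expNorm_monomial, abs_mul, Nat.abs_cast]
  calc |f.coeff m| * m * (t ^ (m + n) / (Nat.factorial (m + n) : ℝ))
      = |f.coeff m| * t ^ (m + n) * (m / (Nat.factorial (m + n) : ℝ)) := by ring
    _ ≤ |f.coeff m| * t ^ (m + n) * (1 / (Nat.factorial m : ℝ)) := by gcongr
    _ = t ^ n * (|f.coeff m| * (t ^ m / (Nat.factorial m : ℝ))) := by ring

theorem basisFreeMonoid_apply (R X : Type*) [CommSemiring R] (I : FreeMonoid X) :
    basisFreeMonoid R X I = FreeMonoid.lift (ι R) I := by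
  simp [basisFreeMonoid, equivMonoidAlgebraFreeMonoid]

theorem expNorm_word_le {t : ℝ} (ht : 0 ≤ t)
    (φ : FreeAlgebra ℝ (Fin 2) →ₐ[ℝ] Module.End ℝ (Polynomial ℝ))
    (hφ0 : φ (ι ℝ (0 : Fin 2)) = Lop 1) (hφ1 : φ (ι ℝ (1 : Fin 2)) = Lop 2)
    (I : FreeMonoid (Fin 2)) (f : Polynomial ℝ) :
    expNorm t (φ (basisFreeMonoid ℝ (Fin 2) I) f) ≤
      t ^ (FreeMonoid.toList I).count 0 * (t ^ 2) ^ (FreeMonoid.toList I).count 1 *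
        expNorm t f := by
  rw [basisFreeMonoid_apply]
  induction I using FreeMonoid.inductionOn' with
  | one => simp
  | of_mul i I ih =>
    rw [map_mul, map_mul, FreeMonoid.lift_eval_of, Module.End.mul_apply]
    fin_cases i
    · simp only [Fin.zero_eta, hφ0]
      refine (expNorm_Lop_le ht le_rfl _).trans ((mul_le_mul_of_nonneg_left ih
        (by positivity)).trans_eq ?_)
      simp [FreeMonoid.toList_mul]
      ring
    · simp only [Fin.mk_one, hφ1]
      refine (expNorm_Lop_le ht one_le_two _).trans ((mul_le_mul_of_nonneg_left ih
        (by positivity)).trans_eq ?_)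
      simp [FreeMonoid.toList_mul]
      ring

theorem expNorm_sum_smul_Lop_X (t : ℝ) (s : Finset ℕ) (p : ℕ → ℝ) :
    expNorm t ((∑ j ∈ s, p j • Lop j) Polynomial.X) =
      t * ∑ j ∈ s, |p j| * t ^ j / (Nat.factorial (j + 1) : ℝ) := by
  have hsum : (∑ j ∈ s, p j • Lop j) Polynomial.X =
      ∑ j ∈ s, Polynomial.monomial (j + 1) (p j) := by
    simp [LinearMap.sum_apply, Lop_X, Polynomial.smul_monomial]
  have hsupp : (∑ j ∈ s, Polynomial.monomial (j + 1) (p j)).support ⊆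
      s.map (addRightEmbedding 1) := by
    intro m hm
    rw [Polynomial.mem_support_iff, Polynomial.finsetSum_coeff] at hm
    obtain ⟨j, hj, hne⟩ := Finset.exists_ne_zero_of_sum_ne_zero hm
    rw [Polynomial.coeff_monomial, ne_eq, ite_eq_right_iff, Classical.not_imp] at hne
    exact Finset.mem_map.2 ⟨j, hj, hne.1⟩
  rw [hsum, expNorm_eq_sum hsupp, Finset.sum_map, Finset.mul_sum]
  refine Finset.sum_congr rfl fun j hj => ?_
  have hc : (∑ i ∈ s, Polynomial.monomial (i + 1) (p i)).coeff (j + 1) = p j := by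
    simp [Polynomial.coeff_monomial, hj]
  rw [addRightEmbedding_apply, hc]
  ring

/-- Lower bound for the quotient norm `Q_{[t]}` on the enveloping algebra of the
formal vector field algebra: if `φ : A₂ → End(ℝ[x])` sends `ω₀ ↦ L₁`, `ω₁ ↦ L₂`,
and `φ(w) = Σ_{j=1}^N p_j L_j`, then the weighted `ℓ¹` norm `R_{t,t²}(w)` of the
representative `w` is at least `Σ_{j=1}^N |p_j|·t^j/(j+1)!`. -/
theorem stmt17 (t : ℝ) (ht : 0 < t) (N : ℕ) (hN : 1 ≤ N) (p : ℕ → ℝ)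
    (φ : FreeAlgebra ℝ (Fin 2) →ₐ[ℝ] Module.End ℝ (Polynomial ℝ))
    (hφ0 : φ (ι ℝ (0 : Fin 2)) = Lop 1) (hφ1 : φ (ι ℝ (1 : Fin 2)) = Lop 2)
    (w : FreeAlgebra ℝ (Fin 2))
    (hw : φ w = ∑ j ∈ Finset.Icc 1 N, p j • Lop j) :
    ∑ j ∈ Finset.Icc 1 N, |p j| * t ^ j / (Nat.factorial (j + 1) : ℝ) ≤
      ∑ I ∈ ((basisFreeMonoid ℝ (Fin 2)).repr w).support,
        |(basisFreeMonoid ℝ (Fin 2)).repr w I| *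
          t ^ (FreeMonoid.toList I).count 0 * (t ^ 2) ^ (FreeMonoid.toList I).count 1 := by
  have hX : expNorm t Polynomial.X = t := by simp [Polynomial.X]
  refine le_of_mul_le_mul_left ?_ ht
  rw [← expNorm_sum_smul_Lop_X, ← hw]
  conv_lhs => rw [← (basisFreeMonoid ℝ (Fin 2)).linearCombination_repr w,
    Finsupp.linearCombination_apply, Finsupp.sum, map_sum, LinearMap.sum_apply]
  refine (expNorm_sum_le ht.le _ _).trans ?_
  rw [Finset.mul_sum]
  refine Finset.sum_le_sum fun I _ => ?_
  rw [map_smul, LinearMap.smul_apply, expNorm_smul]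
  refine (mul_le_mul_of_nonneg_left (expNorm_word_le ht.le φ hφ0 hφ1 I _)
    (abs_nonneg _)).trans_eq ?_
  rw [hX]
  ring
end
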